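/- arXiv:1403.0435 — 3 statements merged into one kernel-verified Lean document; each statement's English description precedes it below -/
import Mathlib

section
/- For every odd integer n ≥ 3, Σ_{0 ≤ k ≤ n, k ≡ 3 (mod 6)} C(n,k) 2^k B_{n-k} equals (n/3)(1 − 2^{n-2} − (−3)^{(n-1)/2}) if n ≡ 1 (mod 6), and equals (n/3)(1 + 2^{n-1} − (−3)^{(n-1)/2}) if n ≡ 3 or 5 (mod 6). -/
open Finset

/-- The binomial expansion of the value of a Bernoulli polynomial in a `ℚ`-algebra. -/
theorem Polynomial.aeval_bernoulli {A : Type*} [CommRing A] [Algebra ℚ A] (n : ℕ) (x : A) :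
    Polynomial.aeval x (Polynomial.bernoulli n) =
      ∑ k ∈ range (n + 1), algebraMap ℚ A (n.choose k * _root_.bernoulli (n - k)) * x ^ k := by
  rw [Polynomial.bernoulli, map_sum, ← sum_range_reflect]
  refine sum_congr rfl fun k hk => ?_
  have hk : k ≤ n := Nat.lt_succ_iff.mp (mem_range.mp hk)
  have h : n + 1 - 1 - k = n - k := by omega
  rw [h, Nat.sub_sub_self hk, Nat.choose_symm hk, Polynomial.aeval_monomial,
    mul_comm (n.choose k : ℚ)]

/-- The difference equation of the Bernoulli polynomials, in a `ℚ`-algebra. -/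
theorem Polynomial.aeval_bernoulli_add_one {A : Type*} [CommRing A] [Algebra ℚ A] (n : ℕ) (x : A) :
    Polynomial.aeval (x + 1) (Polynomial.bernoulli n) =
      Polynomial.aeval x (Polynomial.bernoulli n) + n * x ^ (n - 1) := by
  have h := congrArg (Polynomial.aeval x) (Polynomial.bernoulli_comp_one_add_X n)
  rw [Polynomial.aeval_comp] at h
  simpa [add_comm] using h

/-- The alternating power sum over the sixth roots of unity detects `k ≡ 3 (mod 6)`. -/
theorem alternating_sum_sixth_roots_pow {A : Type*} [CommRing A] {w : A} (hw : w ^ 2 = w - 1)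
    (k : ℕ) :
    1 - w ^ k + (w - 1) ^ k - (-1) ^ k + (-w) ^ k - (1 - w) ^ k =
      if k % 6 = 3 then 6 else 0 := by
  have key (x : A) (hx : x ^ 6 = 1) : x ^ k = x ^ (k % 6) := by
    conv_lhs => rw [← Nat.mod_add_div k 6, pow_add, pow_mul, hx, one_pow, mul_one]
  have h3 : w ^ 3 = -1 := by linear_combination (w + 1) * hw
  rw [key w (by linear_combination (w ^ 3 - 1) * h3),
    key (w - 1) (by rw [← hw]; linear_combination (w ^ 9 - w ^ 6 + w ^ 3 - 1) * h3),
    key (-1) (by norm_num),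
    key (-w) (by linear_combination (w ^ 3 - 1) * h3),
    key (1 - w) (by
      rw [show 1 - w = -w ^ 2 by rw [hw]; ring]
      linear_combination (w ^ 9 - w ^ 6 + w ^ 3 - 1) * h3)]
  have hlt := Nat.mod_lt k (show 6 > 0 by norm_num)
  generalize k % 6 = r at hlt ⊢
  interval_cases r <;> norm_num
  · ring
  · linear_combination -6 * hw
  · ring
  · linear_combination 10 * w * (1 - w) * hw

/-- The power sum of the two primitive cube roots of unity. -/
theorem neg_pow_add_sub_one_pow {A : Type*} [CommRing A] {w : A} (hw : w ^ 2 = w - 1) (l : ℕ) :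
    (-w) ^ l + (w - 1) ^ l = if l % 3 = 0 then 2 else -1 := by
  have key (x : A) (hx : x ^ 3 = 1) : x ^ l = x ^ (l % 3) := by
    conv_lhs => rw [← Nat.mod_add_div l 3, pow_add, pow_mul, hx, one_pow, mul_one]
  have h3 : w ^ 3 = -1 := by linear_combination (w + 1) * hw
  rw [key (-w) (by linear_combination -h3),
    key (w - 1) (by rw [← hw]; linear_combination (w ^ 3 - 1) * h3)]
  have hlt := Nat.mod_lt l (show 3 > 0 by norm_num)
  generalize l % 3 = r at hlt ⊢
  interval_cases r <;> norm_num
  · ring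
  · linear_combination 2 * hw

/-- The sum over `k ≡ 3 (mod 6)` as an alternating sum of values of a Bernoulli polynomial. -/
theorem six_mul_sum_choose_two_pow_bernoulli {A : Type*} [CommRing A] [Algebra ℚ A] {w : A}
    (hw : w ^ 2 = w - 1) (n : ℕ) :
    let B : A → A := fun x => Polynomial.aeval x (Polynomial.bernoulli n)
    6 * algebraMap ℚ A (∑ k ∈ (range (n + 1)).filter (fun k => k % 6 = 3),
      (n.choose k : ℚ) * 2 ^ k * bernoulli (n - k)) =
      B 2 - B (2 * w) + B (2 * (w - 1)) - B (2 * (-1)) + B (2 * (-w)) - B (2 * (1 - w)) := by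
  simp only [Polynomial.aeval_bernoulli, ← sum_add_distrib, ← sum_sub_distrib]
  rw [sum_filter, map_sum, mul_sum]
  refine sum_congr rfl fun k _ => ?_
  have h := alternating_sum_sixth_roots_pow hw k
  simp only [mul_pow (2 : A)]
  split_ifs at h ⊢ with hk
  · simp only [map_mul, map_pow, map_ofNat, map_natCast]
    linear_combination -(n.choose k * 2 ^ k * algebraMap ℚ A (bernoulli (n - k))) * h
  · simp only [map_mul, map_zero, map_natCast]
    linear_combination -(n.choose k * 2 ^ k * algebraMap ℚ A (bernoulli (n - k))) * h

/-- The closed form of the sum, before passing to residues of `n` modulo `6`. -/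
theorem six_mul_sum_choose_two_pow_bernoulli_eq {A : Type*} [CommRing A] [Algebra ℚ A] {w : A}
    (hw : w ^ 2 = w - 1) {l : ℕ} (hl : l ≠ 0) :
    6 * algebraMap ℚ A (∑ k ∈ (range (2 * l + 1 + 1)).filter (fun k => k % 6 = 3),
      ((2 * l + 1).choose k : ℚ) * 2 ^ k * bernoulli (2 * l + 1 - k)) =
      (2 * l + 1) * (2 + 4 ^ l - 2 * (-3) ^ l - 4 ^ l * if l % 3 = 0 then 2 else -1) := by
  rw [six_mul_sum_choose_two_pow_bernoulli hw, ← neg_pow_add_sub_one_pow hw l]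
  have shift (x y : A) (h : y = x + 1) := h ▸ Polynomial.aeval_bernoulli_add_one (2 * l + 1) x
  have e1 := shift 1 2 (by norm_num)
  have e2 := shift 0 1 (by norm_num)
  have e3 := shift (-1) 0 (by norm_num)
  have e4 := shift (2 * (-1)) (-1) (by norm_num)
  have e5 := shift (2 * (w - 1)) (2 * w - 1) (by ring)
  have e6 := shift (2 * w - 1) (2 * w) (by ring)
  have e7 := shift (2 * (-w)) (1 - 2 * w) (by ring)
  have e8 := shift (1 - 2 * w) (2 * (1 - w)) (by ring)
  simp only [Nat.add_sub_cancel, pow_mul] at e1 e2 e3 e4 e5 e6 e7 e8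
  rw [show (2 * (w - 1)) ^ 2 = 4 * -w by linear_combination 4 * hw, mul_pow] at e5
  rw [show (2 * w - 1) ^ 2 = -3 by linear_combination 4 * hw] at e6
  rw [show (2 * -w) ^ 2 = 4 * (w - 1) by linear_combination 4 * hw, mul_pow] at e7
  rw [show (1 - 2 * w) ^ 2 = -3 by linear_combination 4 * hw] at e8
  norm_num [hl] at e1 e2 e3 e4 e5 e6 e7 e8 ⊢
  linear_combination e1 + e2 + e3 + e4 - e5 - e6 - e7 - e8

theorem sum_choose_two_pow_bernoulli_mod_six (n : ℕ) (hn : 3 ≤ n) (hodd : Odd n) :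
    ∑ k ∈ (Finset.range (n + 1)).filter (fun k => k % 6 = 3),
      (n.choose k : ℚ) * 2 ^ k * bernoulli (n - k)
    = if n % 6 = 1 then
        (n : ℚ) / 3 * (1 - 2 ^ (n - 2) - (-3 : ℚ) ^ ((n - 1) / 2))
      else
        (n : ℚ) / 3 * (1 + 2 ^ (n - 1) - (-3 : ℚ) ^ ((n - 1) / 2)) := by
  obtain ⟨l, rfl⟩ := hodd
  obtain ⟨w, hw⟩ : ∃ w : ℂ, w ^ 2 = w - 1 := by
    obtain ⟨s, hs⟩ := IsAlgClosed.exists_pow_nat_eq (-3 : ℂ) (show 0 < 2 by norm_num)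
    exact ⟨(1 + s) / 2, by linear_combination hs / 4⟩
  have h := six_mul_sum_choose_two_pow_bernoulli_eq hw (show l ≠ 0 by omega)
  have h' : 6 * (∑ k ∈ (range (2 * l + 1 + 1)).filter (fun k => k % 6 = 3),
      ((2 * l + 1).choose k : ℚ) * 2 ^ k * bernoulli (2 * l + 1 - k)) =
      (2 * l + 1) * (2 + 4 ^ l - 2 * (-3) ^ l - 4 ^ l * if l % 3 = 0 then 2 else -1) := by
    apply (algebraMap ℚ ℂ).injective
    rw [map_mul, map_ofNat, h]
    split_ifs <;> simp
  have h4 : (4 : ℚ) ^ l = 2 ^ (2 * l) := by rw [pow_mul]; norm_num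
  have hp : (2 : ℚ) ^ (2 * l) = 2 * 2 ^ (2 * l - 1) := by
    rw [← pow_succ']
    congr 1
    omega
  rw [show (2 * l + 1 - 1) / 2 = l by omega, Nat.add_sub_cancel]
  push_cast
  split_ifs with hmod
  · rw [if_pos (by omega), h4, hp] at h'
    linear_combination h' / 6
  · rw [if_neg (by omega), h4] at h'
    linear_combination h' / 6
end

section
/- Let m be a positive integer and let n be a positive even integer. Then Σ_{0 ≤ k ≤ n, k ≡ 2 (mod 4)} C(n,k) (−1)^{(k-2)/4} 2^{n−k/2} m^k B_{n-k} = (n/2) { m^{n-1} ( (−1)^{⌊(n-2)/4⌋} 2^{n/2} − (1+(−1)^m)(−1)^{n/2} ) + 2i Σ_{r=1}^{⌊(m-1)/2⌋} ( (2r−m−mi)^{n-1} − (2r−m+mi)^{n-1} ) }. -/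
open Finset

open Polynomial in
theorem aeval_bernoulli_eq_sum {A : Type*} [CommRing A] [Algebra ℚ A] (n : ℕ) (x : A) :
    aeval x (Polynomial.bernoulli n)
      = ∑ k ∈ range (n + 1), (n.choose k : A) * algebraMap ℚ A (bernoulli (n - k)) * x ^ k := by
  rw [Polynomial.bernoulli_def, map_sum]
  refine sum_congr rfl fun k hk => ?_
  simp only [aeval_monomial, map_mul, map_natCast]
  ring

open Polynomial in
theorem aeval_bernoulli_add_natCast {A : Type*} [CommRing A] [Algebra ℚ A] (n : ℕ) (x : A)
    (N : ℕ) :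
    aeval (x + N) (Polynomial.bernoulli n)
      = aeval x (Polynomial.bernoulli n) + n * ∑ j ∈ range N, (x + j) ^ (n - 1) := by
  induction N with
  | zero => simp
  | succ N ih =>
    have h := congr(aeval (x + (N : A)) $(Polynomial.bernoulli_comp_one_add_X n))
    simp only [aeval_comp, map_add, map_one, aeval_X, nsmul_eq_mul, map_mul,
      map_natCast, map_pow] at h
    rw [sum_range_succ, mul_add, ← add_assoc, ← ih, ← h]
    congr 2
    push_cast
    ring

open Polynomial in
theorem aeval_bernoulli_one_sub {A : Type*} [CommRing A] [Algebra ℚ A] (n : ℕ) (x : A) :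
    aeval (1 - x) (Polynomial.bernoulli n) = (-1) ^ n * aeval x (Polynomial.bernoulli n) := by
  simpa [aeval_comp] using congr(aeval x $(Polynomial.bernoulli_comp_one_sub_X n))

theorem one_add_I_pow_two_mul (l : ℕ) :
    (1 + Complex.I) ^ (2 * l) = 2 ^ l * Complex.I ^ l := by
  rw [pow_mul, ← mul_pow]
  congr 1
  linear_combination Complex.I_sq

theorem one_sub_I_pow_two_mul (l : ℕ) :
    (1 - Complex.I) ^ (2 * l) = 2 ^ l * (-Complex.I) ^ l := by
  rw [pow_mul, ← mul_pow]
  congr 1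
  linear_combination Complex.I_sq

theorem one_add_I_pow_sub_one_sub_I_pow (p : ℕ) :
    (1 + Complex.I) ^ (2 * p + 1) - (1 - Complex.I) ^ (2 * p + 1)
      = Complex.I * (-1) ^ (p / 2) * 2 ^ (p + 1) := by
  rw [pow_succ, pow_succ, one_add_I_pow_two_mul, one_sub_I_pow_two_mul]
  obtain ⟨j, rfl | rfl⟩ := p.even_or_odd'
  · have h : 2 * j / 2 = j := by omega
    rw [h, pow_mul Complex.I, pow_mul (-Complex.I), neg_sq, Complex.I_sq]
    ring
  · have h : (2 * j + 1) / 2 = j := by omega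
    rw [h, pow_succ Complex.I, pow_succ (-Complex.I), pow_mul Complex.I, pow_mul (-Complex.I),
      neg_sq, Complex.I_sq]
    ring

/-- A trapezoidal sum over `0, …, m` folded at its midpoint. -/
theorem sum_range_add_fold {A : Type*} [CommRing A] (f : ℕ → A) (M : ℕ) :
    ∑ j ∈ range M, f (j + 1)
      = ∑ r ∈ Icc 1 (M / 2), (f r + f (M + 1 - r))
        + if Even M then 0 else f ((M + 1) / 2) := by
  induction M using Nat.twoStepInduction generalizing f with
  | zero => simp
  | one => simp
  | more M ih _ =>
    rw [sum_range_succ, sum_range_succ', ih (fun j => f (j + 1))]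
    have h1 : (M + 2) / 2 = M / 2 + 1 := by omega
    have h2 : (M + 2 + 1) / 2 = (M + 1) / 2 + 1 := by omega
    have h3 : Even (M + 2) ↔ Even M := by simp [parity_simps]
    rw [h1, h2, if_congr h3 rfl rfl, ← add_sum_Ioc_eq_sum_Icc (by omega : 1 ≤ M / 2 + 1)]
    have h4 : ∑ r ∈ Ioc 1 (M / 2 + 1), (f r + f (M + 2 + 1 - r))
        = ∑ r ∈ Icc 1 (M / 2), (f (r + 1) + f (M + 1 - r + 1)) := by
      symm
      refine sum_bij (fun r _ => r + 1) ?_ ?_ ?_ ?_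
      · intro r hr; simp at hr ⊢; omega
      · intro r _ s _ h; omega
      · intro r hr; simp at hr; exact ⟨r - 1, by simp; omega, by omega⟩
      · intro r hr
        simp at hr
        congr 2
        omega
    rw [h4]
    simp
    ring

theorem pow_sub_pow_mul_bernoulli (m p k : ℕ) (hk : k ≤ 2 * p + 2) :
    2 * Complex.I * (if k % 4 = 2 then ((2 * p + 2).choose k : ℂ) * (-1 : ℂ) ^ ((k - 2) / 4)
        * (2 : ℂ) ^ (2 * p + 2 - k / 2) * (m : ℂ) ^ k * (bernoulli (2 * p + 2 - k) : ℂ) else 0)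
    = 2 ^ (2 * p + 2) * (((2 * p + 2).choose k : ℂ) * (bernoulli (2 * p + 2 - k) : ℂ)
          * (m * (1 + Complex.I) / 2) ^ k
        - ((2 * p + 2).choose k : ℂ) * (bernoulli (2 * p + 2 - k) : ℂ)
          * (m * (1 - Complex.I) / 2) ^ k)
      + if k = 2 * p + 1 then (p + 1) * 2 * m ^ (2 * p + 1)
          * ((1 + Complex.I) ^ (2 * p + 1) - (1 - Complex.I) ^ (2 * p + 1)) else 0 := by
  obtain ⟨l, rfl | rfl⟩ := k.even_or_odd'
  · rw [if_neg (by omega : ¬ 2 * l = 2 * p + 1), div_pow, div_pow, mul_pow, mul_pow,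
      one_add_I_pow_two_mul, one_sub_I_pow_two_mul]
    obtain ⟨j, rfl | rfl⟩ := l.even_or_odd'
    · rw [if_neg (by omega), pow_mul Complex.I, pow_mul (-Complex.I), neg_sq]
      ring
    · have h1 : (2 * (2 * j + 1) - 2) / 4 = j := by omega
      have h2 : 2 * (2 * j + 1) / 2 = 2 * j + 1 := by omega
      obtain ⟨t, ht⟩ : ∃ t, 2 * p + 2 = t + (2 * j + 1) := ⟨2 * p + 2 - (2 * j + 1), by omega⟩
      have h3 : (2 : ℂ) ^ (2 * (2 * j + 1)) = 2 ^ (2 * j + 1) * 2 ^ (2 * j + 1) := by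
        rw [← pow_add]; congr 1; ring
      rw [if_pos (by omega), h1, h2, ht, Nat.add_sub_cancel, h3, pow_add 2 t, pow_succ Complex.I,
        pow_succ (-Complex.I), pow_mul Complex.I, pow_mul (-Complex.I), neg_sq, Complex.I_sq]
      field_simp
      ring
  · rw [if_neg (by omega)]
    split_ifs with h
    · obtain rfl : l = p := by omega
      rw [show 2 * l + 2 - (2 * l + 1) = 1 by omega, show 2 * l + 2 = 2 * l + 1 + 1 by ring,
        Nat.choose_succ_self_right, bernoulli_one, div_pow, div_pow, mul_pow, mul_pow,
        pow_succ 2 (2 * l + 1)]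
      push_cast
      field_simp
      ring
    · rw [bernoulli_eq_zero_of_odd (n := 2 * p + 2 - (2 * l + 1)) ⟨p - l, by omega⟩ (by omega)]
      simp

theorem sum_choose_pow_bernoulli_mod_four (m n : ℕ) (hm : 0 < m) (hn : 0 < n)
    (heven : Even n) :
    ∑ k ∈ (Finset.range (n + 1)).filter (fun k => k % 4 = 2),
      (n.choose k : ℂ) * (-1 : ℂ) ^ ((k - 2) / 4) * (2 : ℂ) ^ (n - k / 2)
        * (m : ℂ) ^ k * (bernoulli (n - k) : ℂ)
    = (n : ℂ) / 2 *
        ((m : ℂ) ^ (n - 1) *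
            ((-1 : ℂ) ^ ((n - 2) / 4) * 2 ^ (n / 2)
              - (1 + (-1 : ℂ) ^ m) * (-1 : ℂ) ^ (n / 2))
          + 2 * Complex.I *
              ∑ r ∈ Finset.Icc 1 ((m - 1) / 2),
                ((2 * r - m - m * Complex.I) ^ (n - 1)
                  - (2 * r - m + m * Complex.I) ^ (n - 1))) := by
  obtain ⟨p, rfl⟩ : ∃ p, n = 2 * p + 2 := by
    obtain ⟨q, rfl⟩ := heven
    exact ⟨q - 1, by omega⟩
  obtain ⟨M, rfl⟩ : ∃ M, m = M + 1 := ⟨m - 1, by omega⟩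
  set a : ℂ := (M + 1 : ℕ) * (1 + Complex.I) / 2 with ha
  set b : ℂ := (M + 1 : ℕ) * (1 - Complex.I) / 2 with hb
  have hodd : Odd (2 * p + 1) := ⟨p, rfl⟩
  have hdiff : Polynomial.aeval a (Polynomial.bernoulli (2 * p + 2))
      - Polynomial.aeval b (Polynomial.bernoulli (2 * p + 2))
      = (2 * p + 2) * ∑ j ∈ range M, (1 - b + j) ^ (2 * p + 1) := by
    have h1 := aeval_bernoulli_add_natCast (2 * p + 2) (1 - b) M
    have h2 : 1 - b + M = a := by rw [ha, hb]; push_cast; ring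
    rw [h2, aeval_bernoulli_one_sub, Even.neg_one_pow ⟨p + 1, by ring⟩] at h1
    rw [h1]
    push_cast
    ring
  have hfold : 2 ^ (2 * p + 1) * ∑ j ∈ range M, (1 - b + j) ^ (2 * p + 1)
      = ∑ r ∈ Icc 1 (M / 2), ((2 * r - (M + 1 : ℕ) + (M + 1 : ℕ) * Complex.I) ^ (2 * p + 1)
          - (2 * r - (M + 1 : ℕ) - (M + 1 : ℕ) * Complex.I) ^ (2 * p + 1))
        + if Even M then 0 else ((M + 1 : ℕ) * Complex.I) ^ (2 * p + 1) := by
    have h1 := sum_range_add_fold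
      (fun j => (2 * (j : ℂ) - (M + 1 : ℕ) + (M + 1 : ℕ) * Complex.I) ^ (2 * p + 1)) M
    have h2 : 2 ^ (2 * p + 1) * ∑ j ∈ range M, (1 - b + j) ^ (2 * p + 1)
        = ∑ j ∈ range M, (2 * ((j + 1 : ℕ) : ℂ) - (M + 1 : ℕ) + (M + 1 : ℕ) * Complex.I)
          ^ (2 * p + 1) := by
      rw [mul_sum]
      refine sum_congr rfl fun j _ => ?_
      rw [← mul_pow, hb]
      congr 1
      push_cast
      ring
    rw [h2, h1]
    congr 1
    · refine sum_congr rfl fun r hr => ?_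
      rw [mem_Icc] at hr
      rw [sub_eq_add_neg (_ ^ _), ← hodd.neg_pow, Nat.cast_sub (by omega)]
      congr 2
      ring
    · split_ifs with h
      · rfl
      · obtain ⟨t, rfl⟩ := Nat.not_even_iff_odd.mp h
        rw [show (2 * t + 1 + 1) / 2 = t + 1 by omega]
        congr 1
        push_cast
        ring
  have hsum := sum_congr rfl fun k (hk : k ∈ range (2 * p + 2 + 1)) =>
    pow_sub_pow_mul_bernoulli (M + 1) p k (by rw [mem_range] at hk; omega)
  rw [← mul_sum, ← sum_filter, sum_add_distrib, ← mul_sum, sum_sub_distrib,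
    sum_ite_eq' _ (2 * p + 1), if_pos (by simp), one_add_I_pow_sub_one_sub_I_pow] at hsum
  have hA := aeval_bernoulli_eq_sum (2 * p + 2) a
  have hB := aeval_bernoulli_eq_sum (2 * p + 2) b
  simp only [eq_ratCast] at hA hB
  rw [← ha, ← hb, ← hA, ← hB, hdiff] at hsum
  have hmid : (if Even M then 0 else ((M + 1 : ℕ) * Complex.I) ^ (2 * p + 1) : ℂ) * 2
      = (M + 1 : ℕ) ^ (2 * p + 1) * (Complex.I * (-1) ^ p * (1 + (-1) ^ (M + 1))) := by
    rw [mul_pow, pow_succ Complex.I, pow_mul Complex.I, Complex.I_sq]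
    split_ifs with h
    · rw [h.add_one.neg_one_pow]; ring
    · rw [(Nat.not_even_iff_odd.mp h).add_one.neg_one_pow]; ring
  have h1 : (2 * p + 2 - 2) / 4 = p / 2 := by omega
  have h2 : (2 * p + 2) / 2 = p + 1 := by omega
  have h3 : 2 * p + 2 - 1 = 2 * p + 1 := rfl
  rw [h1, h2, h3, Nat.add_sub_cancel]
  rw [sum_sub_distrib] at hfold ⊢
  have hI : (2 * Complex.I) ≠ 0 := by simp
  apply mul_left_cancel₀ hI
  rw [hsum]
  generalize ∑ r ∈ Icc 1 (M / 2), (2 * (r : ℂ) - (M + 1 : ℕ) + (M + 1 : ℕ) * Complex.I)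
    ^ (2 * p + 1) = U at *
  generalize ∑ r ∈ Icc 1 (M / 2), (2 * (r : ℂ) - (M + 1 : ℕ) - (M + 1 : ℕ) * Complex.I)
    ^ (2 * p + 1) = V at *
  have hn_cast : ((2 * p + 2 : ℕ) : ℂ) = 2 * p + 2 := by push_cast; ring
  rw [hn_cast]
  linear_combination 2 * (2 * p + 2) * hfold + (2 * p + 2) * hmid
    - 4 * (p + 1) * (V - U) * Complex.I_sq
end

section
/- For every positive integer n and every complex number x, Σ_{1 ≤ k ≤ n, 4 | k} C(n,k) B_{n-k}(x) ( (−1)^{k/4} 2^{k/2−1} − 1 ) = (n/8) { 2(x−1)^{n-1} − 2x^{n-1} + (x+i)^{n-1} + (x−i)^{n-1} − (x−1+i)^{n-1} − (x−1−i)^{n-1} }. -/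
open Finset

/-- The Bernoulli polynomial `B_n(x) = ∑_{k=0}^n C(n,k) B_k x^{n-k}`, evaluated at `x : ℂ`,
where `B_k` are the Bernoulli numbers (`B_1 = -1/2`). -/
noncomputable def bernoulliPoly (n : ℕ) (x : ℂ) : ℂ :=
  ∑ k ∈ Finset.range (n + 1), (bernoulli k : ℂ) * (n.choose k : ℂ) * x ^ (n - k)

/-- The defining sum of `bernoulliPoly` agrees with Mathlib's Bernoulli polynomial. -/
theorem bernoulliPoly_eq_aeval (n : ℕ) (x : ℂ) :
    bernoulliPoly n x = Polynomial.aeval x (Polynomial.bernoulli n) := by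
  rw [Polynomial.bernoulli, map_sum, bernoulliPoly]
  refine Finset.sum_congr rfl fun k _ => ?_
  simp [Polynomial.aeval_monomial]

theorem bernoulliPoly_add_one (n : ℕ) (x : ℂ) :
    bernoulliPoly n (x + 1) = bernoulliPoly n x + n * x ^ (n - 1) := by
  have h := congrArg (Polynomial.aeval x) (Polynomial.bernoulli_comp_one_add_X n)
  rw [Polynomial.aeval_comp] at h
  simpa [bernoulliPoly_eq_aeval, add_comm] using h

theorem Nat.choose_mul_choose_sub_comm (n j k : ℕ) :
    n.choose j * (n - j).choose k = n.choose k * (n - k).choose j := by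
  have h₁ := Nat.choose_mul (n := n) (k := j + k) (s := j) (by omega)
  have h₂ := Nat.choose_mul (n := n) (k := j + k) (s := k) (by omega)
  rw [Nat.add_sub_cancel_left] at h₁
  rw [Nat.add_sub_cancel] at h₂
  rw [← h₁, ← h₂, Nat.choose_symm_add]

/-- The addition formula for Bernoulli polynomials. -/
theorem bernoulliPoly_add (n : ℕ) (x y : ℂ) :
    bernoulliPoly n (x + y) =
      ∑ k ∈ Finset.range (n + 1), (n.choose k : ℂ) * bernoulliPoly (n - k) x * y ^ k := by
  simp only [bernoulliPoly, Finset.mul_sum, Finset.sum_mul, add_comm x y, add_pow]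
  rw [Finset.sum_comm' (t' := Finset.range (n + 1)) (s' := fun k => Finset.range (n - k + 1))
    (by intro a b; simp only [Finset.mem_range]; omega)]
  refine Finset.sum_congr rfl fun k _ => Finset.sum_congr rfl fun j _ => ?_
  have h : (n.choose j : ℂ) * ((n - j).choose k : ℂ) = n.choose k * (n - k).choose j := by
    exact_mod_cast Nat.choose_mul_choose_sub_comm n j k
  rw [Nat.sub_right_comm n k j]
  linear_combination (bernoulli j : ℂ) * y ^ k * x ^ (n - j - k) * h

/-- A weighted sum of `k`-th powers of the eight nonzero Gaussian integers closest to `0`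
detects divisibility of `k` by four. -/
theorem sum_gaussian_pow_eq_ite (k : ℕ) :
    1 / 8 * ((1 + Complex.I) ^ k + (1 - Complex.I) ^ k + (-1 + Complex.I) ^ k
        + (-1 - Complex.I) ^ k)
      - 1 / 4 * ((1 : ℂ) ^ k + (-1) ^ k + Complex.I ^ k + (-Complex.I) ^ k)
    = if 4 ∣ k then (-4 : ℂ) ^ (k / 4) / 2 - 1 else 0 := by
  have hI := Complex.I_sq
  have h₁ : (1 + Complex.I) ^ 4 = -4 := by grind
  have h₂ : (1 - Complex.I) ^ 4 = -4 := by grind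
  have h₃ : (-1 + Complex.I) ^ 4 = -4 := by grind
  have h₄ : (-1 - Complex.I) ^ 4 = -4 := by grind
  have h₅ : (-1 : ℂ) ^ 4 = 1 := by norm_num
  have h₆ : Complex.I ^ 4 = 1 := Complex.I_pow_four
  have h₇ : (-Complex.I) ^ 4 = 1 := by grind
  obtain ⟨q, r, hr, rfl⟩ : ∃ q r, r < 4 ∧ k = 4 * q + r :=
    ⟨k / 4, k % 4, Nat.mod_lt _ (by norm_num), (Nat.div_add_mod k 4).symm⟩
  have hq : (4 * q + r) / 4 = q := by omega
  have hd : 4 ∣ 4 * q + r ↔ r = 0 := by omega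
  simp only [hq, hd, pow_add, pow_mul, h₁, h₂, h₃, h₄, h₅, h₆, h₇, one_pow]
  interval_cases r <;> simp only [pow_zero, reduceIte, one_ne_zero, OfNat.ofNat_ne_zero] <;> grind

theorem neg_four_pow_div_two_of_four_dvd {k : ℕ} (hk : 0 < k) (h : 4 ∣ k) :
    (-4 : ℂ) ^ (k / 4) / 2 = (-1) ^ (k / 4) * 2 ^ (k / 2 - 1) := by
  obtain ⟨q, rfl⟩ := h
  obtain ⟨m, rfl⟩ : ∃ m, q = m + 1 := ⟨q - 1, by omega⟩
  have h₁ : 4 * (m + 1) / 4 = m + 1 := by omega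
  have h₂ : 4 * (m + 1) / 2 - 1 = 2 * m + 1 := by omega
  rw [h₁, h₂, neg_pow (4 : ℂ), pow_succ 2, pow_mul, pow_succ (4 : ℂ)]
  norm_num
  ring

theorem sum_choose_bernoulliPoly_div_four (n : ℕ) (hn : 0 < n) (x : ℂ) :
    ∑ k ∈ (Finset.Icc 1 n).filter (fun k => 4 ∣ k),
      (n.choose k : ℂ) * bernoulliPoly (n - k) x
        * ((-1 : ℂ) ^ (k / 4) * (2 : ℂ) ^ (k / 2 - 1) - 1)
    = (n : ℂ) / 8 *
        (2 * (x - 1) ^ (n - 1) - 2 * x ^ (n - 1) + (x + Complex.I) ^ (n - 1)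
          + (x - Complex.I) ^ (n - 1) - (x - 1 + Complex.I) ^ (n - 1)
          - (x - 1 - Complex.I) ^ (n - 1)) := by
  have hsum : ∑ k ∈ (Finset.Icc 1 n).filter (fun k => 4 ∣ k),
      (n.choose k : ℂ) * bernoulliPoly (n - k) x
        * ((-1 : ℂ) ^ (k / 4) * (2 : ℂ) ^ (k / 2 - 1) - 1)
      = ∑ k ∈ Finset.range (n + 1), (n.choose k : ℂ) * bernoulliPoly (n - k) x
          * (if 4 ∣ k then (-4 : ℂ) ^ (k / 4) / 2 - 1 else 0) + 1 / 2 * bernoulliPoly n x := by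
    rw [Finset.range_eq_Ico, Finset.sum_eq_sum_Ico_succ_bot (by omega), Finset.sum_filter]
    have hIcc : Finset.Icc 1 n = Finset.Ico (0 + 1) (n + 1) := by
      ext; simp only [Finset.mem_Icc, Finset.mem_Ico]; omega
    have hterm : ∀ k ∈ Finset.Ico (0 + 1) (n + 1),
        (if 4 ∣ k then (n.choose k : ℂ) * bernoulliPoly (n - k) x
          * ((-1 : ℂ) ^ (k / 4) * (2 : ℂ) ^ (k / 2 - 1) - 1) else 0)
        = (n.choose k : ℂ) * bernoulliPoly (n - k) x
          * (if 4 ∣ k then (-4 : ℂ) ^ (k / 4) / 2 - 1 else 0) := by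
      intro k hk
      split_ifs with h
      · rw [neg_four_pow_div_two_of_four_dvd (by simp at hk; omega) h]
      · simp
    rw [hIcc, Finset.sum_congr rfl hterm]
    simp
    ring
  rw [hsum]
  simp only [← sum_gaussian_pow_eq_ite, mul_sub, mul_add, Finset.sum_add_distrib,
    Finset.sum_sub_distrib, mul_left_comm _ (1 / 8 : ℂ), mul_left_comm _ (1 / 4 : ℂ),
    ← Finset.mul_sum, ← bernoulliPoly_add]
  have e₁ := bernoulliPoly_add_one n (x + Complex.I)
  have e₂ := bernoulliPoly_add_one n (x - Complex.I)
  have e₃ := bernoulliPoly_add_one n (x - 1 + Complex.I)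
  have e₄ := bernoulliPoly_add_one n (x - 1 - Complex.I)
  have e₅ := bernoulliPoly_add_one n x
  have e₆ := bernoulliPoly_add_one n (x - 1)
  rw [show x + Complex.I + 1 = x + (1 + Complex.I) by ring] at e₁
  rw [show x - Complex.I + 1 = x + (1 - Complex.I) by ring] at e₂
  rw [show x - 1 + Complex.I + 1 = x + Complex.I by ring,
    show bernoulliPoly n (x - 1 + Complex.I) = bernoulliPoly n (x + (-1 + Complex.I)) by
      congr 1; ring] at e₃
  rw [show x - 1 - Complex.I + 1 = x + -Complex.I by ring,
    show bernoulliPoly n (x - 1 - Complex.I) = bernoulliPoly n (x + (-1 - Complex.I)) by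
      congr 1; ring] at e₄
  rw [show x - 1 + 1 = x by ring,
    show bernoulliPoly n (x - 1) = bernoulliPoly n (x + -1) by congr 1] at e₆
  rw [show bernoulliPoly n (x - Complex.I) = bernoulliPoly n (x + -Complex.I) by congr 1] at e₂
  linear_combination 1 / 8 * e₁ + 1 / 8 * e₂ - 1 / 8 * e₃ - 1 / 8 * e₄ - 1 / 4 * e₅ + 1 / 4 * e₆
end
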